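/- Under the spreadability assumptions, for every n ≥ 1, every π = (P_1,…,P_p) ∈ OP_n, all X_1,…,X_n ∈ A, and all natural numbers N_1,…,N_p, one has ∑ φ_{π⋏κ(i_1,…,i_n)}(X_1,…,X_n) = ∑_{σ: σ ≤ π} φ_σ(X_1,…,X_n) · ∏_{j=1}^p C(N_j, #(σ⌋_{P_j})), where the left-hand sum runs over all tuples (i_1,…,i_n) with i_k ∈ [N_{π(k)}] for every k ∈ [n], and C(N,k) is the binomial coefficient. -/

import Mathlib

open Finset

namespace OSPpaper

/-- A *block* is a subset of `[n] = Fin n`. -/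
abbrev Block (n : ℕ) := Finset (Fin n)

/-- `l` is an ordered set partition of the ground set `E ⊆ [n]`:
a finite sequence of pairwise disjoint nonempty subsets of `E` whose union is `E`. -/
def IsOSP {n : ℕ} (E : Finset (Fin n)) (l : List (Block n)) : Prop :=
  (∀ P ∈ l, P.Nonempty) ∧ l.Pairwise (fun P Q => Disjoint P Q) ∧
    (∀ P ∈ l, P ⊆ E) ∧ ∀ i ∈ E, ∃ P ∈ l, i ∈ P

/-- Union of a list of blocks. -/
def unionList {n : ℕ} (l : List (Block n)) : Block n := l.foldr (· ∪ ·) ∅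

/-- The order on ordered set partitions: `π ≤ σ` iff every block of `σ` is the union
of a contiguous run of blocks of `π` (runs taken in order). -/
def OSPle {n : ℕ} (π σ : List (Block n)) : Prop :=
  ∃ L : List (List (Block n)), L.flatten = π ∧ σ = L.map unionList

/-- The restriction `σ⌋_P`: intersect every block with `P` and delete the empty intersections. -/
def restrict {n : ℕ} (σ : List (Block n)) (P : Block n) : List (Block n) :=
  (σ.map (fun Q => Q ∩ P)).filter (fun Q => decide (Q ≠ ∅))

/-- The quasi-meet `π ⋏ σ`: the concatenation `σ⌋_{P₁} σ⌋_{P₂} ⋯ σ⌋_{P_p}`. -/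
def qmeet {n : ℕ} (π σ : List (Block n)) : List (Block n) :=
  (π.map (fun P => restrict σ P)).flatten

/-- Refinement: every block of `σ` is contained in some block of `τ`.
(As a relation on the underlying unordered partitions, this is the refinement order;
in particular `refines τ η` says `τ̄ ≤ η̄`.) -/
def refines {n : ℕ} (σ τ : List (Block n)) : Prop := ∀ P ∈ σ, ∃ Q ∈ τ, P ⊆ Q

/-- An interval partition of `[m]`, with its blocks listed in (the unique) increasing order:
an ordered set partition whose consecutive blocks are completely ordered. -/
def IsIP {m : ℕ} (l : List (Finset (Fin m))) : Prop :=
  IsOSP Finset.univ l ∧ l.Chain' (fun P Q => ∀ a ∈ P, ∀ b ∈ Q, a < b)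

/-- The (0-based) index `π(k)` of the block of `π` containing `k`. -/
def blockIdx {n : ℕ} (π : List (Block n)) (k : Fin n) : ℕ :=
  π.findIdx (fun P => decide (k ∈ P))

/-- The ordered kernel `κ(i₁,…,iₙ)` of a tuple: the nonempty level sets of the tuple,
listed in increasing order of the value. -/
def kernel {n : ℕ} (i : Fin n → ℕ) : List (Block n) :=
  ((Finset.image i Finset.univ).sort (· ≤ ·)).map
    (fun v => Finset.univ.filter (fun k => i k = v))

/-- `[σ:π] = ∏_{P ∈ π} #(σ⌋_P)`. -/
def colonNum {n : ℕ} (σ π : List (Block n)) : ℕ :=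
  (π.map (fun P => (restrict σ P).length)).prod

/-- `[σ:π]! = ∏_{P ∈ π} #(σ⌋_P)!`. -/
def colonFac {n : ℕ} (σ π : List (Block n)) : ℕ :=
  (π.map (fun P => Nat.factorial (restrict σ P).length)).prod

/-- For `τ̄ ≤ η̄` the sequence `(m_1,…,m_s)`: `m_i` is the (0-based) index of the block of `η`
containing the `i`-th block of `τ`. -/
def mseq {n : ℕ} (τ η : List (Block n)) : List ℕ :=
  τ.map (fun T => η.findIdx (fun E => decide (T ⊆ E)))

/-- number of ascents of a sequence -/
def ascL (l : List ℕ) : ℕ := ((l.zip l.tail).filter (fun p => decide (p.1 < p.2))).length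
/-- number of descents of a sequence -/
def desL (l : List ℕ) : ℕ := ((l.zip l.tail).filter (fun p => decide (p.2 < p.1))).length
/-- number of plateaux of a sequence -/
def platL (l : List ℕ) : ℕ := ((l.zip l.tail).filter (fun p => decide (p.1 = p.2))).length

/-- `asc_η(τ)` -/
def ascN {n : ℕ} (τ η : List (Block n)) : ℕ := ascL (mseq τ η)
/-- `des_η(τ)` -/
def desN {n : ℕ} (τ η : List (Block n)) : ℕ := desL (mseq τ η)
/-- `plat_η(τ)` -/
def platN {n : ℕ} (τ η : List (Block n)) : ℕ := platL (mseq τ η)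

/-- lengths of the maximal ascending runs of a sequence -/
def ascRunLengths (l : List ℕ) : List ℕ :=
  (l.splitBy (fun a b => decide (a < b))).map List.length
/-- lengths of the maximal level (constant) runs of a sequence -/
def levelRunLengths (l : List ℕ) : List ℕ :=
  (l.splitBy (fun a b => decide (a = b))).map List.length

/-- `μ̃(σ,π) = (−1)^{|σ|−|π|} / [σ:π]` (real-valued). -/
noncomputable def muR {n : ℕ} (σ π : List (Block n)) : ℝ :=
  (-1 : ℝ) ^ (σ.length - π.length) / (colonNum σ π : ℝ)

/-- `ζ̃(σ,π) = 1 / [σ:π]!` (real-valued). -/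
noncomputable def zetaR {n : ℕ} (σ π : List (Block n)) : ℝ :=
  1 / (colonFac σ π : ℝ)

/-- The Weisner coefficient `w(τ,η) = ∑_{σ ⋏ η = τ} μ̃(σ, 1̂ₙ)`. -/
noncomputable def wcoef {n : ℕ} (τ η : List (Block n)) : ℝ :=
  ∑ᶠ σ ∈ {σ : List (Block n) | IsOSP Finset.univ σ ∧ qmeet σ η = τ},
    muR σ [(Finset.univ : Block n)]

/-- The Goldberg coefficient `g(τ,η) = ∑_{σ ≥ τ} ζ̃(τ,σ) w(σ,η)`. -/
noncomputable def gcoef {n : ℕ} (τ η : List (Block n)) : ℝ :=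
  ∑ᶠ σ ∈ {σ : List (Block n) | IsOSP Finset.univ σ ∧ OSPle τ σ}, zetaR τ σ * wcoef σ η


/-- The partitioned expectation `φ_τ(X₁,…,Xₙ) = φ̃(ι^{(τ(1))}(X₁) ⋯ ι^{(τ(n))}(Xₙ))`,
where `τ(k)` is the index of the block of `τ` containing `k`. -/
noncomputable def phiPart {A U B : Type*} [Ring A] [Algebra ℂ A] [Ring U] [Algebra ℂ U]
    [AddCommGroup B] [Module ℂ B] (φ : U →ₗ[ℂ] B) (ι : ℕ → (A →ₙₐ[ℂ] U))
    {n : ℕ} (τ : List (Block n)) (X : Fin n → A) : B :=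
  φ ((List.ofFn (fun k => ι (blockIdx τ k) (X k))).prod)

section

variable {n : ℕ}

theorem mem_unionList {l : List (Block n)} {k : Fin n} :
    k ∈ unionList l ↔ ∃ P ∈ l, k ∈ P := by
  induction l with
  | nil => simp [unionList]
  | cons Q l ih =>
    rw [show unionList (Q :: l) = Q ∪ unionList l from rfl]
    simp [ih]

theorem restrict_append (l l' : List (Block n)) (P : Block n) :
    restrict (l ++ l') P = restrict l P ++ restrict l' P := by
  simp [restrict]

theorem restrict_eq_nil {l : List (Block n)} {P : Block n}
    (h : ∀ Q ∈ l, Disjoint Q P) : restrict l P = [] := by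
  simpa [restrict, Finset.disjoint_iff_inter_eq_empty] using h

theorem restrict_eq_self {l : List (Block n)} {P : Block n}
    (hne : ∀ Q ∈ l, Q.Nonempty) (hP : ∀ Q ∈ l, Q ⊆ P) : restrict l P = l := by
  have h : l.map (fun Q => Q ∩ P) = l := by
    conv_rhs => rw [← List.map_id l]
    exact List.map_congr_left fun Q hQ => Finset.inter_eq_left.2 (hP Q hQ)
  rw [restrict, h, List.filter_eq_self]
  intro Q hQ
  simpa using (hne Q hQ).ne_empty

theorem mem_restrict {l : List (Block n)} {P R : Block n} :
    R ∈ restrict l P ↔ R.Nonempty ∧ ∃ Q ∈ l, Q ∩ P = R := by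
  simp [restrict, Finset.nonempty_iff_ne_empty, and_comm]

theorem restrict_restrict (l : List (Block n)) (P Q : Block n) :
    restrict (restrict l Q) P = restrict l (Q ∩ P) := by
  induction l with
  | nil => rfl
  | cons R l ih =>
    have h1 (S : Block n) : restrict (R :: l) S = restrict [R] S ++ restrict l S :=
      restrict_append [R] l S
    rw [h1, restrict_append, ih, h1 (Q ∩ P)]
    congr 1
    by_cases h : R ∩ Q = ∅
    · simp [restrict, h, ← Finset.inter_assoc]
    · simp [restrict, h, Finset.inter_assoc]

theorem isOSP_restrict {σ : List (Block n)} (h : IsOSP Finset.univ σ) (P : Block n) :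
    IsOSP P (restrict σ P) := by
  obtain ⟨-, h2, -, h4⟩ := h
  refine ⟨fun R hR => (mem_restrict.1 hR).1, ?_, ?_, ?_⟩
  · refine List.Pairwise.filter _ (List.Pairwise.map _ (fun Q R hQR => ?_) h2)
    exact hQR.mono Finset.inter_subset_left Finset.inter_subset_left
  · intro R hR
    obtain ⟨-, Q, -, rfl⟩ := mem_restrict.1 hR
    exact Finset.inter_subset_right
  · intro k hk
    obtain ⟨Q, hQ, hkQ⟩ := h4 k (Finset.mem_univ k)
    have : k ∈ Q ∩ P := Finset.mem_inter.2 ⟨hkQ, hk⟩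
    exact ⟨Q ∩ P, mem_restrict.2 ⟨⟨k, this⟩, Q, hQ, rfl⟩, this⟩

theorem IsOSP.unionList_eq {P : Block n} {l : List (Block n)} (h : IsOSP P l) :
    unionList l = P := by
  ext k
  rw [mem_unionList]
  exact ⟨fun ⟨Q, hQ, hk⟩ => h.2.2.1 Q hQ hk, h.2.2.2 k⟩

theorem isOSP_kernel (i : Fin n → ℕ) : IsOSP Finset.univ (kernel i) := by
  refine ⟨?_, ?_, fun _ _ => Finset.subset_univ _, fun k _ => ?_⟩
  · intro P hP
    simp only [kernel, List.mem_map, Finset.mem_sort, Finset.mem_image] at hP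
    obtain ⟨v, ⟨k, -, rfl⟩, rfl⟩ := hP
    exact ⟨k, by simp⟩
  · refine List.Pairwise.map _ (fun v w hvw => ?_) (Finset.sort_nodup _ _)
    rw [Finset.disjoint_left]
    intro k hv hw
    simp only [Finset.mem_filter, Finset.mem_univ, true_and] at hv hw
    exact hvw (hv.symm.trans hw)
  · refine ⟨Finset.univ.filter (fun m => i m = i k), ?_, by simp⟩
    simp only [kernel, List.mem_map, Finset.mem_sort]
    exact ⟨i k, by simp, rfl⟩

theorem isOSP_qmeet {π κ : List (Block n)} (hπ : IsOSP Finset.univ π)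
    (hκ : IsOSP Finset.univ κ) : IsOSP Finset.univ (qmeet π κ) := by
  refine ⟨?_, ?_, fun _ _ => Finset.subset_univ _, fun k _ => ?_⟩
  · intro R hR
    simp only [qmeet, List.mem_flatten, List.mem_map] at hR
    obtain ⟨_, ⟨P, -, rfl⟩, hR⟩ := hR
    exact (mem_restrict.1 hR).1
  · rw [qmeet, List.pairwise_flatten]
    refine ⟨?_, ?_⟩
    · intro l hl
      obtain ⟨P, -, rfl⟩ := List.mem_map.1 hl
      exact (isOSP_restrict hκ P).2.1
    · refine List.Pairwise.map _ (fun P Q hPQ R hR S hS => ?_) hπ.2.1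
      exact hPQ.mono ((isOSP_restrict hκ P).2.2.1 R hR) ((isOSP_restrict hκ Q).2.2.1 S hS)
  · obtain ⟨P, hP, hk⟩ := hπ.2.2.2 k (Finset.mem_univ k)
    obtain ⟨R, hR, hkR⟩ := (isOSP_restrict hκ P).2.2.2 k hk
    exact ⟨R, List.mem_flatten.2 ⟨_, List.mem_map.2 ⟨P, hP, rfl⟩, hR⟩, hkR⟩

theorem OSPle_qmeet (π : List (Block n)) {κ : List (Block n)} (hκ : IsOSP Finset.univ κ) :
    OSPle (qmeet π κ) π := by
  refine ⟨π.map (restrict κ), rfl, ?_⟩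
  rw [List.map_map]
  conv_lhs => rw [← List.map_id π]
  exact List.map_congr_left fun P _ => (isOSP_restrict hκ P).unionList_eq.symm

theorem restrict_qmeet {π : List (Block n)} (hπ : π.Pairwise (fun P Q => Disjoint P Q))
    (κ : List (Block n)) {P : Block n} (hP : P ∈ π) :
    restrict (qmeet π κ) P = restrict κ P := by
  have hcons (Q : Block n) (π : List (Block n)) :
      restrict (qmeet (Q :: π) κ) P = restrict κ (Q ∩ P) ++ restrict (qmeet π κ) P := by
    rw [show qmeet (Q :: π) κ = restrict κ Q ++ qmeet π κ from rfl, restrict_append,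
      restrict_restrict]
  induction π with
  | nil => simp at hP
  | cons Q π ih =>
    rw [List.pairwise_cons] at hπ
    rw [hcons]
    rcases List.mem_cons.1 hP with rfl | hP
    · rw [Finset.inter_self, restrict_eq_nil (l := qmeet π κ), List.append_nil]
      intro R hR
      simp only [qmeet, List.mem_flatten, List.mem_map] at hR
      obtain ⟨_, ⟨Q, hQ, rfl⟩, hR⟩ := hR
      obtain ⟨-, S, -, rfl⟩ := mem_restrict.1 hR
      exact (hπ.1 Q hQ).symm.mono_left Finset.inter_subset_right
    · rw [ih hπ.2 hP, Finset.disjoint_iff_inter_eq_empty.1 (hπ.1 P hP),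
        restrict_eq_nil fun _ _ => Finset.disjoint_empty_right _, List.nil_append]

theorem qmeet_flatten {L : List (List (Block n))} (hne : ∀ P ∈ L.flatten, P.Nonempty)
    (hd : L.flatten.Pairwise (fun P Q => Disjoint P Q)) :
    qmeet (L.map unionList) L.flatten = L.flatten := by
  induction L with
  | nil => rfl
  | cons l L ih =>
    rw [List.flatten_cons, List.pairwise_append] at hd
    obtain ⟨-, hd2, hd3⟩ := hd
    simp only [List.flatten_cons, List.mem_append] at hne
    have h1 : restrict (l ++ L.flatten) (unionList l) = l := by
      rw [restrict_append, restrict_eq_self (fun Q hQ => hne Q (.inl hQ))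
        (fun Q hQ k hk => mem_unionList.2 ⟨Q, hQ, hk⟩), restrict_eq_nil, List.append_nil]
      intro Q hQ
      rw [Finset.disjoint_left]
      intro k hk hkl
      obtain ⟨R, hR, hkR⟩ := mem_unionList.1 hkl
      exact Finset.disjoint_left.1 (hd3 R hR Q hQ) hkR hk
    have h2 : qmeet (L.map unionList) (l ++ L.flatten) = qmeet (L.map unionList) L.flatten := by
      rw [qmeet, qmeet]
      congr 1
      refine List.map_congr_left fun P hP => ?_
      obtain ⟨l', hl', rfl⟩ := List.mem_map.1 hP
      rw [restrict_append, restrict_eq_nil, List.nil_append]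
      intro Q hQ
      rw [Finset.disjoint_left]
      intro k hk hkl
      obtain ⟨R, hR, hkR⟩ := mem_unionList.1 hkl
      exact Finset.disjoint_left.1 (hd3 Q hQ R (List.mem_flatten.2 ⟨l', hl', hR⟩)) hk hkR
    rw [List.map_cons, List.flatten_cons,
      show ∀ (P : Block n) π κ, qmeet (P :: π) κ = restrict κ P ++ qmeet π κ from
        fun _ _ _ => rfl, h1, h2, ih (fun P hP => hne P (.inr hP)) hd2]

theorem qmeet_eq_of_OSPle {π σ : List (Block n)} (hσ : IsOSP Finset.univ σ) (h : OSPle σ π) :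
    qmeet π σ = σ := by
  obtain ⟨L, rfl, rfl⟩ := h
  exact qmeet_flatten hσ.1 hσ.2.1

theorem qmeet_eq_iff {π σ : List (Block n)} (hπ : π.Pairwise (fun P Q => Disjoint P Q))
    (hσ : IsOSP Finset.univ σ) (h : OSPle σ π) (κ : List (Block n)) :
    qmeet π κ = σ ↔ ∀ P ∈ π, restrict κ P = restrict σ P := by
  constructor
  · rintro rfl P hP
    exact (restrict_qmeet hπ κ hP).symm
  · intro hP
    rw [← qmeet_eq_of_OSPle hσ h, qmeet, qmeet, List.map_congr_left hP]

theorem restrict_kernel (i : Fin n → ℕ) (P : Block n) :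
    restrict (kernel i) P =
      ((P.image i).sort (· ≤ ·)).map (fun v => P.filter (fun k => i k = v)) := by
  have hfilter : (P.image i).sort (· ≤ ·) = ((Finset.univ.image i).sort (· ≤ ·)).filter
      (fun v => decide (P.filter (fun k => i k = v) ≠ ∅)) := by
    refine List.Perm.eq_of_pairwise (le := (· ≤ ·)) (fun a b _ _ => le_antisymm) ?_ ?_ ?_
    · exact Finset.pairwise_sort _ _
    · exact (Finset.pairwise_sort _ _).filter _
    · rw [List.perm_ext_iff_of_nodup (Finset.sort_nodup _ _) ((Finset.sort_nodup _ _).filter _)]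
      intro v
      simp only [Finset.mem_sort, List.mem_filter, Finset.mem_image, decide_eq_true_eq,
        ← Finset.nonempty_iff_ne_empty, Finset.Nonempty, Finset.mem_filter, Finset.mem_univ,
        true_and]
      exact ⟨fun h => ⟨h.imp fun _ => And.right, h⟩, And.right⟩
  rw [hfilter, restrict, kernel, List.map_map, List.filter_map]
  have hinter (v : ℕ) : Finset.univ.filter (fun k => i k = v) ∩ P =
      P.filter (fun k => i k = v) := by
    ext k; simp [and_comm]
  simp only [Function.comp_def, hinter]

theorem mem_getElem_iff {l : List (Block n)} (hl : l.Pairwise (fun P Q => Disjoint P Q))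
    {m : ℕ} (hm : m < l.length) {k : Fin n} : k ∈ l[m] ↔ blockIdx l k = m := by
  rw [blockIdx, List.findIdx_eq hm]
  simp only [decide_eq_true_eq, decide_eq_false_iff_not]
  refine ⟨fun hk => ⟨hk, fun j hj hkj => ?_⟩, And.left⟩
  exact Finset.disjoint_left.1 (List.pairwise_iff_getElem.1 hl j m (hj.trans hm) hm hj) hkj hk

theorem IsOSP.blockIdx_lt {P : Block n} {l : List (Block n)} (h : IsOSP P l) {k : Fin n}
    (hk : k ∈ P) : blockIdx l k < l.length := by
  obtain ⟨Q, hQ, hkQ⟩ := h.2.2.2 k hk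
  exact List.findIdx_lt_length_of_exists ⟨Q, hQ, by simpa using hkQ⟩

theorem eqOn_of_restrict_kernel_eq {i i' : Fin n → ℕ} {P : Block n}
    (him : P.image i = P.image i') (h : restrict (kernel i) P = restrict (kernel i') P)
    {k : Fin n} (hk : k ∈ P) : i k = i' k := by
  rw [restrict_kernel, restrict_kernel, him, List.map_inj_left] at h
  have hmem : i k ∈ P.image i' := him ▸ Finset.mem_image_of_mem i hk
  have := h (i k) ((Finset.mem_sort _).2 hmem)
  have hk' : k ∈ P.filter (fun m => i' m = i k) := this ▸ by simp [hk]
  exact (Finset.mem_filter.1 hk').2.symm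

theorem card_image_of_restrict_kernel (i : Fin n → ℕ) (P : Block n) :
    (P.image i).card = (restrict (kernel i) P).length := by
  simp [restrict_kernel]

/-- The tuple whose values on `P` enumerate `S` along the blocks of `l` has image `S` and
restricted kernel `l`. -/
theorem image_and_restrict_kernel_of_enumeration {P : Block n} {l : List (Block n)}
    (hl : IsOSP P l) {S : Finset ℕ} (hS : S.card = l.length) {i : Fin n → ℕ}
    (hi : ∀ k ∈ P, i k = (S.sort (· ≤ ·)).getD (blockIdx l k) 0) :
    P.image i = S ∧ restrict (kernel i) P = l := by
  have hlen : (S.sort (· ≤ ·)).length = l.length := by simp [hS]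
  have hi' (k) (hk : k ∈ P) : ∃ h, i k = (S.sort (· ≤ ·))[blockIdx l k]'h :=
    ⟨hlen ▸ hl.blockIdx_lt hk, by rw [hi k hk, List.getD_eq_getElem]⟩
  have himage : P.image i = S := by
    ext v
    rw [Finset.mem_image]
    constructor
    · rintro ⟨k, hk, rfl⟩
      obtain ⟨h, hik⟩ := hi' k hk
      rw [hik, ← Finset.mem_sort (· ≤ ·)]
      exact List.getElem_mem h
    · intro hv
      obtain ⟨m, hm, rfl⟩ := List.mem_iff_getElem.1 ((Finset.mem_sort (· ≤ ·)).2 hv)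
      have hm' : m < l.length := hlen ▸ hm
      obtain ⟨k, hk⟩ := hl.1 l[m] (List.getElem_mem hm')
      have hkP := hl.2.2.1 _ (List.getElem_mem hm') hk
      refine ⟨k, hkP, ?_⟩
      obtain ⟨h, hik⟩ := hi' k hkP
      rw [hik]
      congr 1
      exact (mem_getElem_iff hl.2.1 hm').1 hk
  refine ⟨himage, ?_⟩
  rw [restrict_kernel, himage]
  refine List.ext_getElem (by simp [hS]) fun m h1 h2 => ?_
  rw [List.getElem_map]
  ext k
  rw [Finset.mem_filter, mem_getElem_iff hl.2.1 h2]
  constructor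
  · rintro ⟨hk, hkm⟩
    obtain ⟨h, hik⟩ := hi' k hk
    exact (List.Nodup.getElem_inj_iff (Finset.sort_nodup S (· ≤ ·))).1 (hik.symm.trans hkm)
  · intro hkm
    have hk : k ∈ P := hl.2.2.1 _ (List.getElem_mem h2) ((mem_getElem_iff hl.2.1 h2).2 hkm)
    obtain ⟨h, hik⟩ := hi' k hk
    refine ⟨hk, ?_⟩
    rw [hik]
    congr 1

theorem card_filter_qmeet_kernel_eq {π σ : List (Block n)} (hπ : IsOSP Finset.univ π)
    (hσ : IsOSP Finset.univ σ) (hle : OSPle σ π) (N : ℕ → ℕ) :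
    ((Fintype.piFinset fun k : Fin n => Finset.Icc 1 (N (blockIdx π k))).filter
        (fun i => qmeet π (kernel i) = σ)).card =
      ∏ j ∈ Finset.range π.length, Nat.choose (N j) ((restrict σ (π.getD j ∅)).length) := by
  have htarget : ∏ j ∈ Finset.range π.length,
      Nat.choose (N j) ((restrict σ (π.getD j ∅)).length) =
      (Fintype.piFinset fun j : Fin π.length =>
        (Finset.Icc 1 (N j)).powersetCard (restrict σ π[j]).length).card := by
    rw [Fintype.card_piFinset, Finset.prod_range]
    simp
  have hidx (j : Fin π.length) {k : Fin n} : k ∈ π[j] ↔ blockIdx π k = j :=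
    mem_getElem_iff hπ.2.1 j.2
  have hlt (k : Fin n) : blockIdx π k < π.length := hπ.blockIdx_lt (Finset.mem_univ k)
  rw [htarget]
  refine Finset.card_bij (fun i _ j => π[j].image i) ?_ ?_ ?_
  · intro i hi
    rw [Finset.mem_filter, Fintype.mem_piFinset, qmeet_eq_iff hπ.2.1 hσ hle] at hi
    rw [Fintype.mem_piFinset]
    intro j
    rw [Finset.mem_powersetCard, card_image_of_restrict_kernel]
    refine ⟨?_, congrArg List.length (hi.2 _ (List.getElem_mem j.2))⟩
    intro v hv
    obtain ⟨k, hk, rfl⟩ := Finset.mem_image.1 hv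
    exact (hidx j).1 hk ▸ hi.1 k
  · intro i hi i' hi' h
    rw [Finset.mem_filter, qmeet_eq_iff hπ.2.1 hσ hle] at hi hi'
    funext k
    have hmem := List.getElem_mem (hlt k)
    exact eqOn_of_restrict_kernel_eq (congrFun h ⟨_, hlt k⟩)
      ((hi.2 _ hmem).trans (hi'.2 _ hmem).symm) ((hidx ⟨_, hlt k⟩).2 rfl)
  · intro S hS
    rw [Fintype.mem_piFinset] at hS
    let i : Fin n → ℕ := fun k => ((S ⟨_, hlt k⟩).sort (· ≤ ·)).getD
      (blockIdx (restrict σ (π[blockIdx π k]'(hlt k))) k) 0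
    have hi (j : Fin π.length) :
        π[j].image i = S j ∧ restrict (kernel i) π[j] = restrict σ π[j] := by
      refine image_and_restrict_kernel_of_enumeration (isOSP_restrict hσ _)
        (Finset.mem_powersetCard.1 (hS j)).2 fun k hk => ?_
      obtain rfl : ⟨_, hlt k⟩ = j := Fin.ext ((hidx j).1 hk)
      rfl
    refine ⟨i, ?_, funext fun j => (hi j).1⟩
    rw [Finset.mem_filter, Fintype.mem_piFinset, qmeet_eq_iff hπ.2.1 hσ hle]
    refine ⟨fun k => ?_, fun P hP => ?_⟩
    · refine (Finset.mem_powersetCard.1 (hS ⟨_, hlt k⟩)).1 ?_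
      rw [← (hi ⟨_, hlt k⟩).1]
      exact Finset.mem_image_of_mem i ((hidx ⟨_, hlt k⟩).2 rfl)
    · obtain ⟨j, hj, rfl⟩ := List.mem_iff_getElem.1 hP
      exact (hi ⟨j, hj⟩).2

theorem finite_setOf_isOSP : {σ : List (Block n) | IsOSP Finset.univ σ}.Finite := by
  refine (List.finite_length_le (Block n) (Fintype.card (Block n))).subset fun σ hσ => ?_
  refine List.Nodup.length_le_card (hσ.2.1.imp_of_mem ?_)
  rintro P Q hP - hd rfl
  exact (hσ.1 P hP).ne_empty (disjoint_self.1 hd)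

end

/-- Under the spreadability assumptions (`A`, `U` unital `ℂ`-algebras,
`B` a complex vector space, `φ̃ : U → B` linear, `ι^{(j)} : A → U` (not necessarily unital)
algebra homomorphisms, satisfying spreadability), for every `n ≥ 1`, every
`π = (P₁,…,P_p) ∈ OP_n`, all `X₁,…,Xₙ ∈ A` and all natural numbers `N₁,…,N_p`:
`∑_{i_k ∈ [N_{π(k)}]} φ_{π⋏κ(i₁,…,iₙ)}(X₁,…,Xₙ)
  = ∑_{σ ≤ π} φ_σ(X₁,…,Xₙ) · ∏_{j=1}^p C(N_j, #(σ⌋_{P_j}))`. -/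
theorem statement10 {A U B : Type*} [Ring A] [Algebra ℂ A] [Ring U] [Algebra ℂ U]
    [AddCommGroup B] [Module ℂ B] (φ : U →ₗ[ℂ] B) (ι : ℕ → (A →ₙₐ[ℂ] U))
    (hspread : ∀ (m : ℕ) (X : Fin m → A) (i : Fin m → ℕ) (h : ℕ → ℕ),
      (∀ p q : Fin m, i p < i q → h (i p) < h (i q)) →
      φ ((List.ofFn (fun k => ι (i k) (X k))).prod)
        = φ ((List.ofFn (fun k => ι (h (i k)) (X k))).prod))
    {n : ℕ} (hn : 1 ≤ n) (π : List (Block n)) (hπ : IsOSP Finset.univ π)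
    (X : Fin n → A) (N : ℕ → ℕ) :
    (∑ᶠ i ∈ {i : Fin n → ℕ | ∀ k : Fin n, i k ∈ Finset.Icc 1 (N (blockIdx π k))},
        phiPart φ ι (qmeet π (kernel i)) X)
    = ∑ᶠ σ ∈ {σ : List (Block n) | IsOSP Finset.univ σ ∧ OSPle σ π},
        (∏ j ∈ Finset.range π.length,
          Nat.choose (N j) ((restrict σ (π.getD j ∅)).length)) • phiPart φ ι σ X := by
  classical
  have hfin : {σ : List (Block n) | IsOSP Finset.univ σ ∧ OSPle σ π}.Finite :=
    finite_setOf_isOSP.subset fun σ hσ => hσ.1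
  have hset : {i : Fin n → ℕ | ∀ k : Fin n, i k ∈ Finset.Icc 1 (N (blockIdx π k))} =
      ↑(Fintype.piFinset fun k : Fin n => Finset.Icc 1 (N (blockIdx π k))) := by
    ext i
    rw [Finset.mem_coe, Fintype.mem_piFinset]
    rfl
  rw [hset, finsum_mem_coe_finset, finsum_mem_eq_finite_toFinset_sum _ hfin,
    ← Finset.sum_fiberwise_of_maps_to (t := hfin.toFinset)
      (g := fun i => qmeet π (kernel i))]
  · refine Finset.sum_congr rfl fun σ hσ => ?_
    obtain ⟨hσ, hle⟩ := hfin.mem_toFinset.1 hσ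
    rw [← card_filter_qmeet_kernel_eq hπ hσ hle N, ← Finset.sum_const]
    refine Finset.sum_congr (by congr) fun i hi => ?_
    rw [(Finset.mem_filter.1 hi).2]
  · intro i _
    exact hfin.mem_toFinset.2 ⟨isOSP_qmeet hπ (isOSP_kernel i), OSPle_qmeet π (isOSP_kernel i)⟩

end OSPpaper
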